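/- Let k ≥ 2, let f : (k+1)^V → ℝ be a nonnegative k-submodular function (not necessarily monotone) with f(0) = 0, let c be a cost function on V, and let B > 0 be a budget. Then every output s of the 1-Guess Greedy algorithm with budget B (under arbitrary tie-breaking) satisfies c(s) ≤ B and 3·f(s) ≥ max{ f(x) : x ∈ (k+1)^V, c(x) ≤ B }. -/

import Mathlib

open Finset

section KSubmodularDefs

variable {V : Type*} [Fintype V] [DecidableEq V] {k : ℕ}

/-- The support of a `k`-tuple `x : V → Fin (k+1)` (value `0` means "not selected"). -/
def ksupp (x : V → Fin (k+1)) : Finset V := Finset.univ.filter fun e => x e ≠ 0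

/-- The meet `x ⊓ y`. -/
def kinf (x y : V → Fin (k+1)) : V → Fin (k+1) :=
  fun e => if x e = y e then x e else 0

/-- The join `x ⊔ y`. -/
def ksup (x y : V → Fin (k+1)) : V → Fin (k+1) :=
  fun e => if y e = 0 ∨ y e = x e then x e else if x e = 0 then y e else 0

/-- `f` is `k`-submodular. -/
def KSubmodular (f : (V → Fin (k+1)) → ℝ) : Prop :=
  ∀ x y : V → Fin (k+1), f (ksup x y) + f (kinf x y) ≤ f x + f y

/-- The partial order `x ⪯ y` on `(k+1)^V`. -/
def kle (x y : V → Fin (k+1)) : Prop := ∀ e : V, x e = 0 ∨ x e = y e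

/-- `f` is monotone with respect to `⪯`. -/
def KMonotone (f : (V → Fin (k+1)) → ℝ) : Prop :=
  ∀ x y : V → Fin (k+1), kle x y → f x ≤ f y

/-- The marginal gain `Δ_{e,j}(x)` of assigning element `e` to component `j`. -/
def margin (f : (V → Fin (k+1)) → ℝ) (x : V → Fin (k+1)) (e : V) (j : Fin (k+1)) : ℝ :=
  f (Function.update x e j) - f x

/-- The total cost `c(x)` of a tuple. -/
def kcost (c : V → ℝ) (x : V → Fin (k+1)) : ℝ := ∑ e ∈ ksupp x, c e

/-- One step of a greedy sequence relative to `o`: pick `e ∉ supp x` and `j ∈ {1,…,k}`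
maximizing the marginal gain over components (a), and with marginal density at least that of
every pair `(e', j')` with `e' ∈ supp o \ supp x` (b). -/
def GreedyStep (f : (V → Fin (k+1)) → ℝ) (c : V → ℝ) (o : V → Fin (k+1))
    (x x' : V → Fin (k+1)) : Prop :=
  ∃ e : V, ∃ j : Fin (k+1), x e = 0 ∧ j ≠ 0 ∧ x' = Function.update x e j ∧
    (∀ j' : Fin (k+1), j' ≠ 0 → margin f x e j' ≤ margin f x e j) ∧
    (∀ e' : V, o e' ≠ 0 → x e' = 0 → ∀ j' : Fin (k+1), j' ≠ 0 →
      margin f x e' j' * c e ≤ margin f x e j * c e')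

/-- `GreedyRun f c B s V0 out`: starting from partial solution `s` with remaining elements `V0`,
the greedy procedure with budget `B` (under some tie-breaking) can terminate with output `out`.
At each step a pair `(e, j)` of maximum marginal density among remaining elements is chosen;
`e` is added (placed in component `j`) iff it fits in the remaining budget, and is removed
from the remaining pool in either case. -/
inductive GreedyRun (f : (V → Fin (k+1)) → ℝ) (c : V → ℝ) (B : ℝ) :
    (V → Fin (k+1)) → Finset V → (V → Fin (k+1)) → Prop where
  | done (s : V → Fin (k+1)) : GreedyRun f c B s ∅ s
  | take (s : V → Fin (k+1)) (V0 : Finset V) (e : V) (j : Fin (k+1))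
      (out : V → Fin (k+1)) (he : e ∈ V0) (hj : j ≠ 0)
      (hbest : ∀ e' ∈ V0, ∀ j' : Fin (k+1), j' ≠ 0 →
        margin f s e' j' / c e' ≤ margin f s e j / c e)
      (hfit : kcost c s + c e ≤ B)
      (hrest : GreedyRun f c B (Function.update s e j) (V0.erase e) out) :
      GreedyRun f c B s V0 out
  | skip (s : V → Fin (k+1)) (V0 : Finset V) (e : V) (j : Fin (k+1))
      (out : V → Fin (k+1)) (he : e ∈ V0) (hj : j ≠ 0)
      (hbest : ∀ e' ∈ V0, ∀ j' : Fin (k+1), j' ≠ 0 →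
        margin f s e' j' / c e' ≤ margin f s e j / c e)
      (hnofit : ¬ kcost c s + c e ≤ B)
      (hrest : GreedyRun f c B s (V0.erase e) out) :
      GreedyRun f c B s V0 out

/-- The `k`-multilinear extension of `f`, as a function of `x : V → Fin (k+1) → ℝ`
(only the coordinates `x e j` with `j ≠ 0` are relevant). -/
noncomputable def kext (f : (V → Fin (k+1)) → ℝ) (x : V → Fin (k+1) → ℝ) : ℝ :=
  ∑ s : V → Fin (k+1), f s *
    ∏ e : V,
      (if s e = 0 then 1 - ∑ j ∈ Finset.univ.erase (0 : Fin (k+1)), x e j else x e (s e))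

/-- The partial derivative of `F` with respect to the coordinate `(e, j)` at the point `x`. -/
noncomputable def pderiv (F : (V → Fin (k+1) → ℝ) → ℝ) (e : V) (j : Fin (k+1))
    (x : V → Fin (k+1) → ℝ) : ℝ :=
  deriv (fun t : ℝ => F (Function.update x e (Function.update (x e) j t))) (x e j)

/-- Membership in the domain `Δ_k^V` of the multilinear extension. -/
def inSimplex (x : V → Fin (k+1) → ℝ) : Prop :=
  (∀ e : V, ∀ j : Fin (k+1), j ≠ 0 → 0 ≤ x e j ∧ x e j ≤ 1) ∧
  (∀ e : V, ∑ j ∈ Finset.univ.erase (0 : Fin (k+1)), x e j ≤ 1)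

end KSubmodularDefs

section GreedyAnalysis

variable {V : Type*} {k : ℕ}

lemma mem_ksupp [Fintype V] {x : V → Fin (k+1)} {e : V} : e ∈ ksupp x ↔ x e ≠ 0 := by
  simp [ksupp]

lemma kle_refl (x : V → Fin (k+1)) : kle x x := fun _ => Or.inr rfl

lemma exists_ne_zero_ne (hk : 2 ≤ k) (j : Fin (k+1)) : ∃ i : Fin (k+1), i ≠ 0 ∧ i ≠ j := by
  by_cases h : j = ⟨1, by omega⟩
  · exact ⟨⟨2, by omega⟩, by simp [Fin.ext_iff], by simp [h, Fin.ext_iff]⟩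
  · exact ⟨⟨1, by omega⟩, by simp [Fin.ext_iff], fun h' => h h'.symm⟩

/-- The tuple that agrees with `s` on its support and with `o` elsewhere. -/
def kmerge (s o : V → Fin (k+1)) : V → Fin (k+1) := fun e => if s e = 0 then o e else s e

variable [DecidableEq V]

/-- Orthant submodularity: marginal gains decrease along `⪯`. -/
lemma KSubmodular.margin_anti {f : (V → Fin (k+1)) → ℝ} (hsub : KSubmodular f)
    {x z : V → Fin (k+1)} (hxz : kle x z) {e : V} (he : z e = 0) {j : Fin (k+1)} (hj : j ≠ 0) :
    margin f z e j ≤ margin f x e j := by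
  have h := hsub (Function.update x e j) z
  have hxe : x e = 0 := by
    rcases hxz e with h | h
    · exact h
    · rw [h, he]
  have h1 : ksup (Function.update x e j) z = Function.update z e j := by
    funext a
    by_cases hae : a = e
    · subst hae; simp [ksup, he]
    · rcases hxz a with h | h
      · simp only [ksup, Function.update_of_ne hae, h]
        split_ifs <;> simp_all
      · simp [ksup, hae, h]
  have h2 : kinf (Function.update x e j) z = x := by
    funext a
    by_cases hae : a = e
    · subst hae; simp [kinf, he, hj, hxe]
    · rcases hxz a with h | h
      · simp [kinf, hae, h]
      · simp [kinf, hae, h]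
  rw [h1, h2] at h
  unfold margin
  linarith

/-- Pairwise monotonicity. -/
lemma KSubmodular.margin_add_nonneg {f : (V → Fin (k+1)) → ℝ} (hsub : KSubmodular f)
    {x : V → Fin (k+1)} {e : V} (he : x e = 0) {i j : Fin (k+1)} (hi : i ≠ 0) (hj : j ≠ 0)
    (hij : i ≠ j) : 0 ≤ margin f x e i + margin f x e j := by
  have h := hsub (Function.update x e i) (Function.update x e j)
  have h1 : ksup (Function.update x e i) (Function.update x e j) = x := by
    funext a
    by_cases hae : a = e
    · subst hae; simp [ksup, he, hi, hj, hij.symm]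
    · simp [ksup, hae]
  have h2 : kinf (Function.update x e i) (Function.update x e j) = x := by
    funext a
    by_cases hae : a = e
    · subst hae; simp [kinf, he, hij]
    · simp [kinf, hae]
  rw [h1, h2] at h
  unfold margin
  linarith

/-- If `j` maximizes the gain of `e` at `x`, every gain of `e` above `x` is at least minus
that maximum. -/
lemma KSubmodular.neg_margin_le {f : (V → Fin (k+1)) → ℝ} (hsub : KSubmodular f) (hk : 2 ≤ k)
    {x z : V → Fin (k+1)} (hxz : kle x z) {e : V} (he : z e = 0) {j : Fin (k+1)}
    (hmax : ∀ i : Fin (k+1), i ≠ 0 → margin f x e i ≤ margin f x e j) {i : Fin (k+1)}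
    (hi : i ≠ 0) : -margin f x e j ≤ margin f z e i := by
  obtain ⟨i', hi', hne⟩ := exists_ne_zero_ne hk i
  have h1 := hsub.margin_add_nonneg he hi' hi hne
  have h2 := hsub.margin_anti hxz he hi'
  have h3 := hmax i' hi'
  linarith

lemma margin_le_of_density {f : (V → Fin (k+1)) → ℝ} {c : V → ℝ} (hc : ∀ e, 0 < c e)
    {s : V → Fin (k+1)} {V0 : Finset V} {e : V} {j : Fin (k+1)} (he : e ∈ V0)
    (hbest : ∀ e' ∈ V0, ∀ j' : Fin (k+1), j' ≠ 0 →
      margin f s e' j' / c e' ≤ margin f s e j / c e)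
    (i : Fin (k+1)) (hi : i ≠ 0) : margin f s e i ≤ margin f s e j :=
  (div_le_div_iff_of_pos_right (hc e)).1 (hbest e he i hi)

lemma kle_update {x : V → Fin (k+1)} {e : V} (he : x e = 0) (j : Fin (k+1)) :
    kle x (Function.update x e j) := by
  intro a
  by_cases h : a = e
  · subst h; exact Or.inl he
  · right; simp [h]

lemma KSubmodular.best_margin_nonneg {f : (V → Fin (k+1)) → ℝ} (hsub : KSubmodular f)
    (hk : 2 ≤ k) {x : V → Fin (k+1)} {e : V} (he : x e = 0) {j : Fin (k+1)} (hj : j ≠ 0)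
    (hmax : ∀ i : Fin (k+1), i ≠ 0 → margin f x e i ≤ margin f x e j) :
    0 ≤ margin f x e j := by
  have := hsub.neg_margin_le hk (kle_refl x) he hmax hj
  linarith

lemma update_eq_zero_of_mem_erase {s : V → Fin (k+1)} {V0 : Finset V}
    (hV0 : ∀ e ∈ V0, s e = 0) {e : V} {j : Fin (k+1)} :
    ∀ e' ∈ V0.erase e, Function.update s e j e' = 0 := by
  intro e' he'
  rw [Finset.mem_erase] at he'
  rw [Function.update_of_ne he'.1]
  exact hV0 e' he'.2

lemma kmerge_update {s o : V → Fin (k+1)} {e : V} {j : Fin (k+1)} (hj : j ≠ 0) :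
    kmerge (Function.update s e j) o = Function.update (kmerge s o) e j := by
  funext a
  by_cases h : a = e
  · subst h; simp [kmerge, hj]
  · simp [kmerge, h]

/-- The loss in `kmerge s o` caused by one greedy assignment. -/
lemma KSubmodular.kmerge_loss {f : (V → Fin (k+1)) → ℝ} (hsub : KSubmodular f) (hk : 2 ≤ k)
    {s o : V → Fin (k+1)} {e : V} (he : s e = 0) {j : Fin (k+1)} (hj : j ≠ 0)
    (hmax : ∀ i : Fin (k+1), i ≠ 0 → margin f s e i ≤ margin f s e j) :
    f (kmerge s o) ≤ f (kmerge (Function.update s e j) o) +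
      (if o e = 0 then 1 else 2) * margin f s e j := by
  rw [kmerge_update hj]
  set m := kmerge s o with hm
  set m0 := Function.update m e 0 with hm0
  have hme : m e = o e := by simp [hm, kmerge, he]
  have hle : kle s m0 := by
    intro a
    by_cases ha : a = e
    · subst ha; exact Or.inl he
    · by_cases hs : s a = 0
      · exact Or.inl hs
      · right; simp [hm0, hm, ha, kmerge, hs]
  have h0 : m0 e = 0 := by simp [hm0]
  have h1 := hsub.neg_margin_le hk hle h0 hmax hj
  have hu : Function.update m0 e j = Function.update m e j := by simp [hm0]
  split_ifs with ho
  · have : m0 = m := by rw [hm0, ← ho, ← hme, Function.update_eq_self]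
    rw [this] at h1
    change _ ≤ f (Function.update m e j) - f m at h1
    linarith
  · have h2 := (hsub.margin_anti hle h0 ho).trans (hmax _ ho)
    have h3 : Function.update m0 e (o e) = m := by
      rw [hm0, Function.update_idem, ← hme, Function.update_eq_self]
    have h4 : margin f m0 e (o e) = f m - f m0 := by rw [margin, h3]
    have h5 : margin f m0 e j = f (Function.update m e j) - f m0 := by rw [margin, hu]
    linarith

lemma KSubmodular.piecewise_le {f : (V → Fin (k+1)) → ℝ} (hsub : KSubmodular f)
    {s o : V → Fin (k+1)} (T : Finset V) (hT : ∀ e ∈ T, s e = 0 ∧ o e ≠ 0) :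
    f (T.piecewise o s) ≤ f s + ∑ e ∈ T, margin f s e (o e) := by
  induction T using Finset.induction_on with
  | empty => simp
  | insert e T heT ih =>
    have ih := ih fun a ha => hT a (Finset.mem_insert_of_mem ha)
    obtain ⟨hse, hoe⟩ := hT e (Finset.mem_insert_self e T)
    have hle : kle s (T.piecewise o s) := by
      intro a
      by_cases ha : a ∈ T
      · exact Or.inl (hT a (Finset.mem_insert_of_mem ha)).1
      · exact Or.inr (Finset.piecewise_eq_of_notMem _ _ _ ha).symm
    have h := hsub.margin_anti hle (by rw [Finset.piecewise_eq_of_notMem _ _ _ heT, hse]) hoe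
    rw [Finset.piecewise_insert, Finset.sum_insert heT]
    rw [margin] at h
    linarith

variable [Fintype V]

lemma ksupp_update {x : V → Fin (k+1)} {e : V} {j : Fin (k+1)} (hj : j ≠ 0) :
    ksupp (Function.update x e j) = insert e (ksupp x) := by
  ext a
  by_cases h : a = e
  · subst h; simp [mem_ksupp, hj]
  · simp [mem_ksupp, h]

lemma kcost_update {c : V → ℝ} {x : V → Fin (k+1)} {e : V} {j : Fin (k+1)}
    (he : x e = 0) (hj : j ≠ 0) :
    kcost c (Function.update x e j) = kcost c x + c e := by
  rw [kcost, ksupp_update hj, Finset.sum_insert (by simp [mem_ksupp, he]), kcost, add_comm]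

lemma GreedyRun.kcost_le {f : (V → Fin (k+1)) → ℝ} {c : V → ℝ} {B : ℝ}
    {s out : V → Fin (k+1)} {V0 : Finset V} (h : GreedyRun f c B s V0 out)
    (hV0 : ∀ e ∈ V0, s e = 0) (hs : kcost c s ≤ B) : kcost c out ≤ B := by
  induction h with
  | done s => exact hs
  | take s V0 e j out he hj hbest hfit hrest ih =>
    exact ih (update_eq_zero_of_mem_erase hV0) (by rwa [kcost_update (hV0 e he) hj])
  | skip s V0 e j out he hj hbest hnofit hrest ih =>
    exact ih (fun e' he' => hV0 e' (Finset.mem_of_mem_erase he')) hs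

lemma GreedyRun.le_out {f : (V → Fin (k+1)) → ℝ} {c : V → ℝ} {B : ℝ}
    {s out : V → Fin (k+1)} {V0 : Finset V} (h : GreedyRun f c B s V0 out)
    (hsub : KSubmodular f) (hk : 2 ≤ k) (hc : ∀ e, 0 < c e)
    (hV0 : ∀ e ∈ V0, s e = 0) : f s ≤ f out := by
  induction h with
  | done s => exact le_rfl
  | take s V0 e j out he hj hbest hfit hrest ih =>
    have h1 := hsub.best_margin_nonneg hk (hV0 e he) hj (margin_le_of_density hc he hbest)
    have h2 := ih (update_eq_zero_of_mem_erase hV0)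
    unfold margin at h1
    linarith
  | skip s V0 e j out he hj hbest hnofit hrest ih =>
    exact ih (fun e' he' => hV0 e' (Finset.mem_of_mem_erase he'))

lemma kmerge_eq_piecewise (s o : V → Fin (k+1)) :
    kmerge s o = (ksupp o \ ksupp s).piecewise o s := by
  funext a
  by_cases hs : s a = 0 <;> by_cases ho : o a = 0 <;>
    simp [kmerge, Finset.piecewise, mem_ksupp, hs, ho]

/-- The approximation guarantee from an intermediate state `s` of the greedy procedure, where `A`
is the gain collected so far on elements outside `supp o`, and `b` bounds `f` on the singletons
below `o`. -/
lemma GreedyRun.three_mul_ge {f : (V → Fin (k+1)) → ℝ} {c : V → ℝ} {B : ℝ}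
    {s out : V → Fin (k+1)} {V0 : Finset V} (h : GreedyRun f c B s V0 out)
    (hsub : KSubmodular f) (hk : 2 ≤ k) (hc : ∀ e, 0 < c e)
    {o : V → Fin (k+1)} (ho : kcost c o ≤ B) {b : ℝ} (hb0 : 0 ≤ b)
    (hb : ∀ e, o e ≠ 0 → margin f (fun _ => 0) e (o e) ≤ b)
    (hV0 : ∀ e ∈ V0, s e = 0) (hcover : ∀ e, o e ≠ 0 → s e = 0 → e ∈ V0)
    {A : ℝ} (hA : 0 ≤ A) (hloss : f o + A + 2 * b ≤ f (kmerge s o) + 2 * f s)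
    (hdens : ∀ e ∈ V0, ∀ j : Fin (k+1), j ≠ 0 →
      margin f s e j * (∑ a ∈ ksupp s \ ksupp o, c a) ≤ A * c e) :
    f o ≤ 3 * f out := by
  induction h generalizing A with
  | done s =>
    have : kmerge s o = s := by
      funext a
      by_cases hs : s a = 0
      · by_cases hoa : o a = 0
        · simp [kmerge, hs, hoa]
        · simpa using hcover a hoa hs
      · simp [kmerge, hs]
    rw [this] at hloss
    linarith
  | take s V0 e j out he hj hbest hfit hrest ih =>
    have hse := hV0 e he
    have hmax := margin_le_of_density hc he hbest
    have hΔ := hsub.best_margin_nonneg hk hse hj hmax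
    have hl := hsub.kmerge_loss (o := o) hk hse hj hmax
    have hf : f (Function.update s e j) = f s + margin f s e j := by simp [margin]
    have hcover' : ∀ a, o a ≠ 0 → Function.update s e j a = 0 → a ∈ V0.erase e := by
      intro a hoa hsa
      by_cases hae : a = e
      · subst hae; simp [hj] at hsa
      · rw [Function.update_of_ne hae] at hsa
        exact Finset.mem_erase.2 ⟨hae, hcover a hoa hsa⟩
    have hC : 0 ≤ ∑ a ∈ ksupp s \ ksupp o, c a := Finset.sum_nonneg fun a _ => (hc a).le
    have hanti : ∀ e' ∈ V0.erase e, ∀ i : Fin (k+1), i ≠ 0 →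
        margin f (Function.update s e j) e' i ≤ margin f s e' i := fun e' he' i hi =>
      hsub.margin_anti (kle_update hse j) (update_eq_zero_of_mem_erase hV0 e' he') hi
    by_cases hoe : o e = 0
    · rw [if_pos hoe] at hl
      refine ih (update_eq_zero_of_mem_erase hV0) hcover' (add_nonneg hA hΔ) (by linarith) ?_
      intro e' he' i hi
      have he'0 := Finset.mem_of_mem_erase he'
      have hsum : ∑ a ∈ ksupp (Function.update s e j) \ ksupp o, c a =
          c e + ∑ a ∈ ksupp s \ ksupp o, c a := by
        rw [ksupp_update hj, Finset.insert_sdiff_of_notMem _ (by simp [mem_ksupp, hoe]),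
          Finset.sum_insert (by simp [mem_ksupp, hse])]
      rw [hsum]
      have h1 := hdens e' he'0 i hi
      have h2 := (div_le_div_iff₀ (hc e') (hc e)).1 (hbest e' he'0 i hi)
      have h3 := mul_le_mul_of_nonneg_right (hanti e' he' i hi) (add_nonneg (hc e).le hC)
      linarith
    · rw [if_neg hoe] at hl
      refine ih (update_eq_zero_of_mem_erase hV0) hcover' hA (by linarith) ?_
      intro e' he' i hi
      have he'0 := Finset.mem_of_mem_erase he'
      rw [ksupp_update hj, Finset.insert_sdiff_of_mem _ (by simpa [mem_ksupp] using hoe)]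
      exact (mul_le_mul_of_nonneg_right (hanti e' he' i hi) hC).trans (hdens e' he'0 i hi)
  | skip s V0 e j out he hj hbest hnofit hrest ih =>
    have hV0' : ∀ a ∈ V0.erase e, s a = 0 := fun a ha => hV0 a (Finset.mem_of_mem_erase ha)
    by_cases hoe : o e = 0
    · refine ih hV0' ?_ hA hloss fun a ha => hdens a (Finset.mem_of_mem_erase ha)
      intro a hoa hsa
      refine Finset.mem_erase.2 ⟨?_, hcover a hoa hsa⟩
      rintro rfl
      exact hoa hoe
    · have hout := hrest.le_out hsub hk hc hV0'
      have hse := hV0 e he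
      have heT : e ∈ ksupp o \ ksupp s := by simp [mem_ksupp, hoe, hse]
      have hpw := hsub.piecewise_le (s := s) (o := o) (ksupp o \ ksupp s)
        (by simp +contextual [mem_ksupp])
      rw [← kmerge_eq_piecewise, ← Finset.add_sum_erase _ _ heT] at hpw
      have h0 : margin f s e (o e) ≤ b :=
        (hsub.margin_anti (x := fun _ => 0) (fun _ => Or.inl rfl) hse hoe).trans (hb e hoe)
      set T := (ksupp o \ ksupp s).erase e with hT
      set C := ∑ a ∈ ksupp s \ ksupp o, c a with hCdef
      have ho' : ∑ a ∈ ksupp o ∩ ksupp s, c a + (c e + ∑ a ∈ T, c a) = kcost c o := by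
        rw [hT, Finset.add_sum_erase _ _ heT, Finset.sum_inter_add_sum_sdiff, kcost]
      have hs' : ∑ a ∈ ksupp o ∩ ksupp s, c a + C = kcost c s := by
        rw [Finset.inter_comm, hCdef, Finset.sum_inter_add_sum_sdiff, kcost]
      have hTC : ∑ a ∈ T, c a ≤ C := by linarith
      have hCpos : 0 < C := by
        have : 0 ≤ ∑ a ∈ T, c a := Finset.sum_nonneg fun a _ => (hc a).le
        linarith
      have hsumT : (∑ a ∈ T, margin f s a (o a)) * C ≤ A * C := by
        refine le_trans ?_ (mul_le_mul_of_nonneg_left hTC hA)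
        rw [Finset.sum_mul, Finset.mul_sum]
        refine Finset.sum_le_sum fun a ha => ?_
        simp only [hT, Finset.mem_erase, Finset.mem_sdiff, mem_ksupp, not_not] at ha
        exact hdens a (hcover a ha.2.1 ha.2.2) _ ha.2.1
      have := le_of_mul_le_mul_right hsumT hCpos
      linarith

end GreedyAnalysis

/-- The 1-Guess Greedy algorithm is a `1/3`-approximation for (not necessarily
monotone) `k`-submodular maximization (`k ≥ 2`) under a knapsack constraint. -/
theorem one_guess_greedy_nonmonotone_third
    {V : Type*} [Fintype V] [DecidableEq V] {k : ℕ} (hk : 2 ≤ k)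
    (f : (V → Fin (k+1)) → ℝ)
    (hsub : KSubmodular f)
    (hnonneg : ∀ x : V → Fin (k+1), 0 ≤ f x) (hzero : f (fun _ => 0) = 0)
    (c : V → ℝ) (hc : ∀ e : V, 0 < c e) (B : ℝ) (hB : 0 < B)
    (g : (V → Fin (k+1)) → (V → Fin (k+1)))
    (hg : ∀ y : V → Fin (k+1), (ksupp y).card = 1 → kcost c y ≤ B →
      GreedyRun f c B y (Finset.univ \ ksupp y) (g y))
    (s : V → Fin (k+1))
    (hmem : s = (fun _ => 0) ∨
      ∃ y : V → Fin (k+1), (ksupp y).card = 1 ∧ kcost c y ≤ B ∧ s = g y)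
    (hbest0 : f (fun _ => 0) ≤ f s)
    (hbest : ∀ y : V → Fin (k+1), (ksupp y).card = 1 → kcost c y ≤ B → f (g y) ≤ f s) :
    kcost c s ≤ B ∧ ∀ x : V → Fin (k+1), kcost c x ≤ B → f x ≤ 3 * f s := by
  have hV0 : ∀ y : V → Fin (k+1), ∀ e ∈ Finset.univ \ ksupp y, y e = 0 := by
    intro y e he
    simpa [mem_ksupp] using he
  refine ⟨?_, fun o ho => ?_⟩
  · rcases hmem with rfl | ⟨y, hy1, hyB, rfl⟩
    · simpa [kcost, ksupp] using hB.le
    · exact (hg y hy1 hyB).kcost_le (hV0 y) hyB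
  · rcases (ksupp o).eq_empty_or_nonempty with hemp | hne
    · have : o = fun _ => 0 := by
        funext e
        by_contra h
        exact Finset.notMem_empty e (hemp ▸ mem_ksupp.2 h)
      rw [this, hzero]
      linarith [hnonneg s]
    · obtain ⟨r, hr, hrmax⟩ := Finset.exists_max_image (ksupp o)
        (fun e => f (Function.update (fun _ => 0) e (o e))) hne
      have hor := mem_ksupp.1 hr
      set y : V → Fin (k+1) := Function.update (fun _ => 0) r (o r) with hy
      have hysupp : ksupp y = {r} := by
        rw [hy, ksupp_update hor]
        simp [ksupp]
      have hy1 : (ksupp y).card = 1 := by rw [hysupp, Finset.card_singleton]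
      have hyB : kcost c y ≤ B := by
        refine le_trans ?_ ho
        rw [kcost, hysupp, kcost]
        exact Finset.sum_le_sum_of_subset_of_nonneg (by simpa using hr) fun a _ _ => (hc a).le
      have hmerge : kmerge y o = o := by
        funext a
        by_cases ha : a = r
        · subst ha; simp [kmerge, hy, hor]
        · simp [kmerge, hy, ha]
      have hempty : ksupp y \ ksupp o = ∅ := by
        rw [hysupp]
        simpa using hr
      have key := (hg y hy1 hyB).three_mul_ge hsub hk hc ho (hnonneg y)
        (fun e he => by
          rw [margin, hzero, sub_zero]
          exact hrmax e (mem_ksupp.2 he))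
        (hV0 y) (fun e _ he => by simpa [mem_ksupp] using he) le_rfl
        (by rw [hmerge]; linarith) (fun e _ j _ => by simp [hempty])
      linarith [hbest y hy1 hyB]
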